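/- arXiv:2304.10028 — 2 statements merged into one kernel-verified Lean document; each statement's English description precedes it below -/
import Mathlib

section
/- Let n ≥ 1 and let a : Fin n → ℕ satisfy a i ≥ 1 for all i. If the density ∑_{i : Fin n} 1/(a i) is at most 4/3 (as a real number), then there exist two disjoint sets S₁, S₂ ⊆ Fin n with S₁ ∪ S₂ = Fin n such that each S_j admits a pinwheel schedule. -/
/-- A subset `S` of the objects admits a pinwheel schedule for the window lengths `a`:
there is an infinite schedule `σ` such that every `i ∈ S` appears at least once in
any `a i` consecutive time steps. -/
def HasPinwheelSchedule {n : ℕ} (a : Fin n → ℕ) (S : Set (Fin n)) : Prop :=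
  ∃ σ : ℕ → Fin n, ∀ i ∈ S, ∀ t : ℕ, ∃ s : ℕ, t ≤ s ∧ s < t + a i ∧ σ s = i

lemma pw_assign {ι : Type*} [DecidableEq ι] (x : ℕ) (hx : 0 < x) (e : ι → ℕ) (S : Finset ι) :
    (∑ i ∈ S, (1 : ℝ) / 2 ^ e i ≤ x) →
    ∃ c : ι → ℕ, ∀ i ∈ S, ∀ j ∈ S, ∀ t : ℕ, t ≡ c i [MOD x * 2 ^ e i] →
      t ≡ c j [MOD x * 2 ^ e j] → i = j := by
  induction S using Finset.induction_on_max_value e with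
  | empty => intro _; exact ⟨fun _ => 0, by simp⟩
  | insert a s has hmax ih =>
    intro hsum
    rw [Finset.sum_insert has] at hsum
    have hpos : (0 : ℝ) < 1 / 2 ^ e a := by positivity
    obtain ⟨c, hc⟩ := ih (by linarith)
    have key : ∃ r : ℕ, ∀ j ∈ s, ¬ r ≡ c j [MOD x * 2 ^ e j] := by
      by_contra hcon
      push Not at hcon
      have hsub : Finset.range (x * 2 ^ e a) ⊆ s.biUnion (fun j =>
          (Finset.range (2 ^ (e a - e j))).image
            (fun q => c j % (x * 2 ^ e j) + (x * 2 ^ e j) * q)) := by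
        intro r hr
        obtain ⟨j, hj, hrj⟩ := hcon r
        rw [Finset.mem_biUnion]
        refine ⟨j, hj, ?_⟩
        rw [Finset.mem_image]
        refine ⟨r / (x * 2 ^ e j), ?_, ?_⟩
        · rw [Finset.mem_range] at hr ⊢
          rw [Nat.div_lt_iff_lt_mul (by positivity)]
          calc r < x * 2 ^ e a := hr
            _ = 2 ^ (e a - e j) * (x * 2 ^ e j) := by
              rw [mul_left_comm, ← pow_add, Nat.sub_add_cancel (hmax j hj)]
        · have hrj2 : r % (x * 2 ^ e j) = c j % (x * 2 ^ e j) := hrj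
          simp only [← hrj2]; exact Nat.mod_add_div _ _
      have h1 := Finset.card_le_card hsub
      have h2 := Finset.card_biUnion_le (s := s) (t := fun j =>
          (Finset.range (2 ^ (e a - e j))).image
            (fun q => c j % (x * 2 ^ e j) + (x * 2 ^ e j) * q))
      have h3 : ∑ j ∈ s, ((Finset.range (2 ^ (e a - e j))).image
            (fun q => c j % (x * 2 ^ e j) + (x * 2 ^ e j) * q)).card ≤
            ∑ j ∈ s, 2 ^ (e a - e j) := by
        apply Finset.sum_le_sum
        intro j _
        exact Finset.card_image_le.trans (by simp)
      rw [Finset.card_range] at h1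
      have h4 : x * 2 ^ e a ≤ ∑ j ∈ s, 2 ^ (e a - e j) := h1.trans (h2.trans h3)
      have h5 : ((x * 2 ^ e a : ℕ) : ℝ) ≤ ((∑ j ∈ s, 2 ^ (e a - e j) : ℕ) : ℝ) := by
        exact_mod_cast h4
      have h6 : ((∑ j ∈ s, 2 ^ (e a - e j) : ℕ) : ℝ) = 2 ^ e a * ∑ j ∈ s, (1 : ℝ) / 2 ^ e j := by
        push_cast
        rw [Finset.mul_sum]
        apply Finset.sum_congr rfl
        intro j hj
        rw [mul_one_div, pow_sub₀ _ (by norm_num) (hmax j hj)]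
        rfl
      rw [h6] at h5
      push_cast at h5
      rw [mul_comm] at h5
      have := le_of_mul_le_mul_left h5 (by positivity)
      linarith
    obtain ⟨r, hr⟩ := key
    have hdvd : ∀ j ∈ s, x * 2 ^ e j ∣ x * 2 ^ e a := fun j hj =>
      mul_dvd_mul_left _ (pow_dvd_pow _ (hmax j hj))
    have hne : ∀ j ∈ s, j ≠ a := fun j hj h => has (h ▸ hj)
    refine ⟨Function.update c a r, ?_⟩
    intro i hi j hj t h1 h2
    rw [Finset.mem_insert] at hi hj
    rcases hi with rfl | hi <;> rcases hj with rfl | hj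
    · rfl
    · rw [Function.update_self] at h1
      rw [Function.update_of_ne (hne j hj)] at h2
      exact absurd ((h1.of_dvd (hdvd j hj)).symm.trans h2) (hr j hj)
    · rw [Function.update_self] at h2
      rw [Function.update_of_ne (hne i hi)] at h1
      exact absurd ((h2.of_dvd (hdvd i hi)).symm.trans h1) (hr i hi)
    · rw [Function.update_of_ne (hne i hi)] at h1
      rw [Function.update_of_ne (hne j hj)] at h2
      exact hc i hi j hj t h1 h2

lemma pw_fill {ι : Type*} [DecidableEq ι] (x : ℕ) (hx : 0 < x) (e : ι → ℕ) (S : Finset ι) :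
    ((x : ℝ) ≤ ∑ i ∈ S, (1 : ℝ) / 2 ^ e i) →
    ∃ F ⊆ S, ∑ i ∈ F, (1 : ℝ) / 2 ^ e i = x := by
  induction S using Finset.induction_on_max_value e with
  | empty =>
    intro h
    have : (0 : ℝ) < x := by exact_mod_cast hx
    simp at h; omega
  | insert a s has hmax ih =>
    intro hsum
    by_cases hs : (x : ℝ) ≤ ∑ i ∈ s, (1 : ℝ) / 2 ^ e i
    · obtain ⟨F, hF, h⟩ := ih hs
      exact ⟨F, hF.trans (Finset.subset_insert _ _), h⟩
    · refine ⟨insert a s, subset_rfl, ?_⟩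
      push Not at hs
      rw [Finset.sum_insert has] at hsum ⊢
      have h6 : ((∑ j ∈ s, 2 ^ (e a - e j) : ℕ) : ℝ) = 2 ^ e a * ∑ j ∈ s, (1 : ℝ) / 2 ^ e j := by
        push_cast
        rw [Finset.mul_sum]
        apply Finset.sum_congr rfl
        intro j hj
        rw [mul_one_div, pow_sub₀ _ (by norm_num) (hmax j hj)]
        rfl
      have hp : (0 : ℝ) < 2 ^ e a := by positivity
      have h7 : ((∑ j ∈ s, 2 ^ (e a - e j) : ℕ) : ℝ) < ((2 ^ e a * x : ℕ) : ℝ) := by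
        rw [h6]; push_cast
        exact mul_lt_mul_of_pos_left hs hp
      have h8 : (∑ j ∈ s, 2 ^ (e a - e j) : ℕ) + 1 ≤ 2 ^ e a * x := by exact_mod_cast h7
      have h9 : ((∑ j ∈ s, 2 ^ (e a - e j) : ℕ) : ℝ) + 1 ≤ 2 ^ e a * x := by exact_mod_cast h8
      rw [h6] at h9
      have h10 : (2 : ℝ) ^ e a * (1 / 2 ^ e a + ∑ j ∈ s, (1 : ℝ) / 2 ^ e j) ≤ 2 ^ e a * x := by
        rw [mul_add, mul_one_div_cancel hp.ne']; linarith
      exact le_antisymm (le_of_mul_le_mul_left h10 hp) hsum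

lemma pw_sched {n : ℕ} (hn : 1 ≤ n) (a : Fin n → ℕ) (x : ℕ) (hx : 0 < x) (e : Fin n → ℕ)
    (S : Finset (Fin n)) (hle : ∀ i ∈ S, x * 2 ^ e i ≤ a i)
    (hsum : ∑ i ∈ S, (1 : ℝ) / 2 ^ e i ≤ x) : HasPinwheelSchedule a (S : Set (Fin n)) := by
  classical
  obtain ⟨c, hc⟩ := pw_assign x hx e S hsum
  refine ⟨fun t => if h : ∃ i ∈ S, t ≡ c i [MOD x * 2 ^ e i] then h.choose else ⟨0, hn⟩, ?_⟩
  intro i hi t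
  have hi' : i ∈ S := hi
  set m := x * 2 ^ e i with hm
  have hmpos : 0 < m := by positivity
  have hle' : m ≤ a i := hle i hi'
  obtain ⟨s, h1, h2, h3⟩ : ∃ s, t ≤ s ∧ s < t + m ∧ s ≡ c i [MOD m] := by
    have hlt := Nat.mod_lt (c i + (m - 1) * t) hmpos
    refine ⟨t + (c i + (m - 1) * t) % m, by omega, by omega, ?_⟩
    have : t + (c i + (m - 1) * t) % m ≡ t + (c i + (m - 1) * t) [MOD m] :=
      Nat.ModEq.add_left _ (Nat.mod_modEq _ _)
    refine this.trans ?_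
    have h : t + (c i + (m - 1) * t) = c i + m * t := by
      obtain ⟨q, hq⟩ : ∃ q, m = q + 1 := ⟨m - 1, by omega⟩
      rw [hq]; simp; ring
    rw [h]
    simp [Nat.ModEq]
  refine ⟨s, h1, by omega, ?_⟩
  have hex : ∃ j ∈ S, s ≡ c j [MOD x * 2 ^ e j] := ⟨i, hi', h3⟩
  simp only [dif_pos hex]
  exact hc _ hex.choose_spec.1 _ hi' s hex.choose_spec.2 h3

lemma pw_sum_le {ι : Type*} (S : Finset ι) (f d : ι → ℝ) (C : ℝ) (h : ∀ i ∈ S, f i ≤ C * d i) :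
    ∑ i ∈ S, f i ≤ C * ∑ i ∈ S, d i := by
  rw [Finset.mul_sum]; exact Finset.sum_le_sum h

lemma pw_loss {a e : ℕ} (ha : 1 ≤ a) {C : ℝ} (h : (a : ℝ) ≤ C * 2 ^ e) :
    (1 : ℝ) / 2 ^ e ≤ C * (1 / (a : ℝ)) := by
  have : (0 : ℝ) < a := by exact_mod_cast ha
  rw [mul_one_div, div_le_div_iff₀ (by positivity) this]; linarith

lemma pw_split {ι : Type*} [DecidableEq ι] (S : Finset ι) (p : ι → Prop) [DecidablePred p]
    (f : ι → ℝ) :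
    ∑ i ∈ S, f i = ∑ i ∈ S with p i, f i + ∑ i ∈ S with ¬ p i, f i :=
  (Finset.sum_filter_add_sum_filter_not S p f).symm

/-- class P: `2 ^ k ≤ a < 3 / 2 * 2 ^ k`. -/
def pwP (a : ℕ) : Prop := 2 * a < 3 * 2 ^ Nat.log 2 a

instance : DecidablePred pwP := fun a => inferInstanceAs (Decidable (2 * a < 3 * 2 ^ Nat.log 2 a))

/-- exponent for base 3. -/
def pwE (a : ℕ) : ℕ := if pwP a then Nat.log 2 a - 2 else Nat.log 2 a - 1

lemma pw_lo {a : ℕ} (ha : 1 ≤ a) : 2 ^ Nat.log 2 a ≤ a := Nat.pow_log_le_self 2 (by omega)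

lemma pw_hi (a : ℕ) : a < 2 * 2 ^ Nat.log 2 a := by
  have := Nat.lt_pow_succ_log_self (b := 2) (by norm_num) a
  rw [pow_succ] at this; omega

lemma pw_log_ge {a j : ℕ} (h : 2 ^ j ≤ a) : ∃ q, Nat.log 2 a = q + j := by
  have hp : 0 < 2 ^ j := by positivity
  have := Nat.le_log_of_pow_le (b := 2) (by norm_num) h
  exact ⟨Nat.log 2 a - j, by omega⟩

lemma pw_T_ge {a : ℕ} (ha : 1 ≤ a) (h : ¬ pwP a) : 3 ≤ a := by
  by_contra hc
  have : a = 1 ∨ a = 2 := by omega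
  rcases this with rfl | rfl <;> exact h (by unfold pwP; norm_num [Nat.log])

/-- base 3 rounding -/
lemma pw_E_le {a : ℕ} (ha : 3 ≤ a) : 3 * 2 ^ pwE a ≤ a := by
  unfold pwE
  split_ifs with h
  · have h4 : 4 ≤ a := by
      by_contra hc
      have : a = 3 := by omega
      subst this
      revert h; unfold pwP; norm_num [Nat.log]
    obtain ⟨q, hq⟩ := pw_log_ge (j := 2) (by omega : 2 ^ 2 ≤ a)
    have := pw_lo (by omega : 1 ≤ a)
    rw [hq] at this ⊢
    rw [pow_add] at this
    simp only [Nat.add_sub_cancel]; omega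
  · obtain ⟨q, hq⟩ := pw_log_ge (j := 1) (by omega : 2 ^ 1 ≤ a)
    unfold pwP at h
    rw [hq] at h ⊢
    rw [pow_add] at h
    simp only [Nat.add_sub_cancel]; omega

lemma pw_E_P {a : ℕ} (ha : 3 ≤ a) (h : pwP a) : (1 : ℝ) / 2 ^ pwE a ≤ 6 * (1 / (a : ℝ)) := by
  apply pw_loss (by omega)
  have h4 : 4 ≤ a := by
    by_contra hc
    have : a = 3 := by omega
    subst this
    revert h; unfold pwP; norm_num [Nat.log]
  obtain ⟨q, hq⟩ := pw_log_ge (j := 2) (by omega : 2 ^ 2 ≤ a)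
  have he : pwE a = q := by unfold pwE; rw [if_pos h, hq]; omega
  unfold pwP at h
  rw [hq, pow_add] at h
  rw [he]
  have : a ≤ 6 * 2 ^ q := by omega
  exact_mod_cast this

lemma pw_E_T {a : ℕ} (ha : 1 ≤ a) (h : ¬ pwP a) : (1 : ℝ) / 2 ^ pwE a ≤ 4 * (1 / (a : ℝ)) := by
  apply pw_loss ha
  obtain ⟨q, hq⟩ := pw_log_ge (j := 1) (by have := pw_T_ge ha h; omega : 2 ^ 1 ≤ a)
  have he : pwE a = q := by unfold pwE; rw [if_neg h, hq]; omega
  have := pw_hi a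
  rw [hq, pow_add] at this
  rw [he]
  have : a ≤ 4 * 2 ^ q := by omega
  exact_mod_cast this

lemma pw_2_P {a : ℕ} (ha : 1 ≤ a) (h : pwP a) :
    (1 : ℝ) / 2 ^ Nat.log 2 a ≤ (3 / 2) * (1 / (a : ℝ)) := by
  apply pw_loss ha
  unfold pwP at h
  have : (2 : ℝ) * a ≤ 3 * 2 ^ Nat.log 2 a := by exact_mod_cast h.le
  linarith

lemma pw_2_all {a : ℕ} (ha : 1 ≤ a) :
    (1 : ℝ) / 2 ^ Nat.log 2 a ≤ 2 * (1 / (a : ℝ)) := by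
  apply pw_loss ha
  exact_mod_cast (pw_hi a).le

lemma pw_mem_le {n : ℕ} (a : Fin n → ℕ) (S : Finset (Fin n)) (i : Fin n) (hi : i ∈ S) :
    1 / (a i : ℝ) ≤ ∑ i ∈ S, 1 / (a i : ℝ) :=
  Finset.single_le_sum (f := fun i => 1 / (a i : ℝ)) (fun _ _ => by positivity) hi

lemma pw_ge3 {n : ℕ} (a : Fin n → ℕ) (ha : ∀ i, 1 ≤ a i) (S : Finset (Fin n))
    (h : ∑ i ∈ S with pwP (a i), 1 / (a i : ℝ) ≤ 1 / 3) : ∀ i ∈ S, 3 ≤ a i := by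
  intro i hi
  by_cases hp : pwP (a i)
  · have h1 := (pw_mem_le a _ i (Finset.mem_filter.2 ⟨hi, hp⟩)).trans h
    have hpos : (0 : ℝ) < a i := by exact_mod_cast ha i
    rw [div_le_div_iff₀ hpos (by norm_num)] at h1
    have : (3 : ℝ) ≤ a i := by linarith
    exact_mod_cast this
  · exact pw_T_ge (ha i) hp

/-- base 3 scheduling -/
lemma pw_sched3 {n : ℕ} (hn : 1 ≤ n) (a : Fin n → ℕ) (ha : ∀ i, 1 ≤ a i) (S : Finset (Fin n))
    (h : ∑ i ∈ S with pwP (a i), 1 / (a i : ℝ) ≤ 1 / 3)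
    (h2 : 6 * ∑ i ∈ S with pwP (a i), 1 / (a i : ℝ) +
      ∑ i ∈ S with ¬ pwP (a i), (1 : ℝ) / 2 ^ pwE (a i) ≤ 3) :
    HasPinwheelSchedule a (S : Set (Fin n)) := by
  classical
  have h3 := pw_ge3 a ha S h
  refine pw_sched hn a 3 (by norm_num) (fun i => pwE (a i)) S
    (fun i hi => pw_E_le (h3 i hi)) ?_
  rw [pw_split S (fun i => pwP (a i))]
  have := pw_sum_le (S.filter (fun i => pwP (a i))) (fun i => (1 : ℝ) / 2 ^ pwE (a i))
    (fun i => 1 / (a i : ℝ)) 6 (fun i hi => by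
      rw [Finset.mem_filter] at hi
      exact pw_E_P (h3 i hi.1) hi.2)
  push_cast
  linarith

lemma pw_sumE {n : ℕ} (a : Fin n → ℕ) (ha : ∀ i, 1 ≤ a i) (S : Finset (Fin n)) :
    ∑ i ∈ S with ¬ pwP (a i), (1 : ℝ) / 2 ^ pwE (a i) ≤
      4 * ∑ i ∈ S with ¬ pwP (a i), 1 / (a i : ℝ) :=
  pw_sum_le _ _ _ 4 (fun i hi => by
    rw [Finset.mem_filter] at hi
    exact pw_E_T (ha i) hi.2)

/-- base 2 scheduling -/
lemma pw_sched2 {n : ℕ} (hn : 1 ≤ n) (a : Fin n → ℕ) (ha : ∀ i, 1 ≤ a i) (S : Finset (Fin n))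
    (h : 3 / 2 * ∑ i ∈ S with pwP (a i), 1 / (a i : ℝ) +
      2 * ∑ i ∈ S with ¬ pwP (a i), 1 / (a i : ℝ) ≤ 1) :
    HasPinwheelSchedule a (S : Set (Fin n)) := by
  classical
  refine pw_sched hn a 1 (by norm_num) (fun i => Nat.log 2 (a i)) S
    (fun i hi => by rw [one_mul]; exact pw_lo (ha i)) ?_
  rw [pw_split S (fun i => pwP (a i))]
  have h1 := pw_sum_le (S.filter (fun i => pwP (a i))) (fun i => (1 : ℝ) / 2 ^ Nat.log 2 (a i))
    (fun i => 1 / (a i : ℝ)) (3 / 2) (fun i hi => by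
      rw [Finset.mem_filter] at hi
      exact pw_2_P (ha i) hi.2)
  have h2 := pw_sum_le (S.filter (fun i => ¬ pwP (a i))) (fun i => (1 : ℝ) / 2 ^ Nat.log 2 (a i))
    (fun i => 1 / (a i : ℝ)) 2 (fun i hi => pw_2_all (ha i))
  push_cast
  linarith

lemma pw_7_12 {n : ℕ} (hn : 1 ≤ n) (a : Fin n → ℕ) (ha : ∀ i, 1 ≤ a i) (S : Finset (Fin n))
    (h : ∑ i ∈ S, 1 / (a i : ℝ) ≤ 7 / 12) : HasPinwheelSchedule a (S : Set (Fin n)) := by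
  classical
  rw [pw_split S (fun i => pwP (a i))] at h
  by_cases ht : ∑ i ∈ S with ¬ pwP (a i), 1 / (a i : ℝ) ≤ 1 / 4
  · apply pw_sched2 hn a ha; linarith
  · push Not at ht
    have := pw_sumE a ha S
    apply pw_sched3 hn a ha <;> linarith

/-- the conclusion -/
def pwGoal {n : ℕ} (a : Fin n → ℕ) : Prop := ∃ S₁ S₂ : Set (Fin n),
      Disjoint S₁ S₂ ∧ S₁ ∪ S₂ = Set.univ ∧
      HasPinwheelSchedule a S₁ ∧ HasPinwheelSchedule a S₂

lemma pw_goal {n : ℕ} (a : Fin n → ℕ) (S : Finset (Fin n))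
    (h1 : HasPinwheelSchedule a (S : Set (Fin n)))
    (h2 : HasPinwheelSchedule a ((Finset.univ \ S : Finset (Fin n)) : Set (Fin n))) :
    pwGoal a := by
  refine ⟨_, _, ?_, ?_, h1, h2⟩
  · rw [Finset.disjoint_coe]; exact Finset.disjoint_sdiff
  · ext i; simp

lemma pw_goal34 {n : ℕ} (hn : 1 ≤ n) (a : Fin n → ℕ) (ha : ∀ i, 1 ≤ a i)
    (hdens : ∑ i : Fin n, (1 : ℝ) / (a i : ℝ) ≤ 4 / 3) (S : Finset (Fin n))
    (h1 : HasPinwheelSchedule a (S : Set (Fin n)))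
    (h : 3 / 4 ≤ ∑ i ∈ S, 1 / (a i : ℝ)) : pwGoal a := by
  refine pw_goal a S h1 (pw_7_12 hn a ha _ ?_)
  have := Finset.sum_sdiff (f := fun i => 1 / (a i : ℝ)) (Finset.subset_univ S)
  linarith

/-- filling a machine and continuing if the filling is efficient -/
lemma pw_fill34 {n : ℕ} (hn : 1 ≤ n) (a : Fin n → ℕ) (ha : ∀ i, 1 ≤ a i)
    (hdens : ∑ i : Fin n, (1 : ℝ) / (a i : ℝ) ≤ 4 / 3) (S : Finset (Fin n))
    (x : ℕ) (hx : 0 < x) (e : Fin n → ℕ) (hle : ∀ i ∈ S, x * 2 ^ e i ≤ a i) (C : ℝ)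
    (hC : ∀ i ∈ S, (1 : ℝ) / 2 ^ e i ≤ C * (1 / (a i : ℝ)))
    (hC2 : C * (3 / 4) ≤ x) (hC0 : 0 < C)
    (h : (x : ℝ) ≤ ∑ i ∈ S, (1 : ℝ) / 2 ^ e i) : pwGoal a := by
  obtain ⟨F, hF, hs⟩ := pw_fill x hx e S h
  refine pw_goal34 hn a ha hdens F (pw_sched hn a x hx e F (fun i hi => hle i (hF hi)) hs.le) ?_
  have := pw_sum_le F _ _ C (fun i hi => hC i (hF hi))
  rw [hs] at this
  exact le_of_mul_le_mul_left (hC2.trans this) hC0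

lemma pw_main {n : ℕ} (hn : 1 ≤ n) (a : Fin n → ℕ) (ha : ∀ i, 1 ≤ a i)
    (hdens : ∑ i : Fin n, (1 : ℝ) / (a i : ℝ) ≤ 4 / 3) : pwGoal a := by
  classical
  set P : Finset (Fin n) := Finset.univ.filter (fun i => pwP (a i)) with hP
  set T : Finset (Fin n) := Finset.univ.filter (fun i => ¬ pwP (a i)) with hT
  have hPm : ∀ i, i ∈ P ↔ pwP (a i) := fun i => by simp [hP]
  have hTm : ∀ i, i ∈ T ↔ ¬ pwP (a i) := fun i => by simp [hT]
  have hPT : Finset.univ \ P = T := by ext i; simp [hPm, hTm]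
  have hd : ∑ i ∈ P, 1 / (a i : ℝ) + ∑ i ∈ T, 1 / (a i : ℝ) ≤ 4 / 3 := by
    rw [pw_split Finset.univ (fun i => pwP (a i))] at hdens
    exact hdens
  have hTE : ∀ i ∈ T, 3 * 2 ^ pwE (a i) ≤ a i := fun i hi =>
    pw_E_le (pw_T_ge (ha i) ((hTm i).1 hi))
  -- case B ≥ 1
  by_cases hB : (3 : ℝ) ≤ ∑ i ∈ T, (1 : ℝ) / 2 ^ pwE (a i)
  · exact pw_fill34 hn a ha hdens T 3 (by norm_num) (fun i => pwE (a i)) hTE 4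
      (fun i hi => pw_E_T (ha i) ((hTm i).1 hi)) (by norm_num) (by norm_num) (by exact_mod_cast hB)
  push Not at hB
  -- case A ≤ 1
  by_cases hA : ∑ i ∈ P, (1 : ℝ) / 2 ^ Nat.log 2 (a i) ≤ 1
  · refine pw_goal a P ?_ ?_
    · exact pw_sched hn a 1 (by norm_num) (fun i => Nat.log 2 (a i)) P
        (fun i hi => by rw [one_mul]; exact pw_lo (ha i)) (by exact_mod_cast hA)
    · rw [hPT]
      exact pw_sched hn a 3 (by norm_num) (fun i => pwE (a i)) T hTE (by exact_mod_cast hB.le)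
  push Not at hA
  by_cases hc : (∃ i ∈ T, a i = 3) ∨ 1 / 2 ≤ ∑ i ∈ T, 1 / (a i : ℝ)
  · -- fill machine one with P, the rest in base 3
    obtain ⟨F, hF, hs⟩ := pw_fill 1 one_pos (fun i => Nat.log 2 (a i)) P (by exact_mod_cast hA.le)
    have hFd := pw_sum_le F (fun i => (1 : ℝ) / 2 ^ Nat.log 2 (a i)) (fun i => 1 / (a i : ℝ))
      (3 / 2) (fun i hi => pw_2_P (ha i) ((hPm i).1 (hF hi)))
    rw [hs] at hFd
    push_cast at hFd
    refine pw_goal a F (pw_sched hn a 1 one_pos (fun i => Nat.log 2 (a i)) F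
        (fun i hi => by rw [one_mul]; exact pw_lo (ha i)) hs.le) ?_
    have e1 : (Finset.univ \ F).filter (fun i => pwP (a i)) = P \ F := by
      ext i; simp [hPm, and_comm]
    have e2 : (Finset.univ \ F).filter (fun i => ¬ pwP (a i)) = T := by
      ext i
      simp only [Finset.mem_filter, Finset.mem_sdiff, Finset.mem_univ, true_and, hTm]
      exact ⟨fun h => h.2, fun h => ⟨fun h' => h ((hPm i).1 (hF h')), h⟩⟩
    have hPF := Finset.sum_sdiff (f := fun i => 1 / (a i : ℝ)) hF
    have hTs : ∑ i ∈ T, (1 : ℝ) / 2 ^ pwE (a i) ≤ 4 * ∑ i ∈ T, 1 / (a i : ℝ) :=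
      pw_sumE a ha Finset.univ
    rcases hc with ⟨i, hi, hi3⟩ | hc
    · have ht3 := pw_mem_le a T i hi
      have h3 : (1 : ℝ) / (a i : ℝ) = 1 / 3 := by rw [hi3]; norm_num
      have hE3 : (1 : ℝ) / 2 ^ pwE (a i) = 1 := by
        rw [hi3]; unfold pwE pwP; norm_num [Nat.log]
      have hTs' : ∑ j ∈ T.erase i, (1 : ℝ) / 2 ^ pwE (a j) ≤
          4 * ∑ j ∈ T.erase i, 1 / (a j : ℝ) :=
        pw_sum_le _ _ _ 4 (fun j hj => pw_E_T (ha j) ((hTm j).1 (Finset.mem_of_mem_erase hj)))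
      have q1 := Finset.add_sum_erase T (fun j => (1 : ℝ) / 2 ^ pwE (a j)) hi
      have q2 := Finset.add_sum_erase T (fun j => (1 : ℝ) / (a j : ℝ)) hi
      apply pw_sched3 hn a ha
      · rw [e1]; linarith
      · rw [e1, e2]; linarith
    · apply pw_sched3 hn a ha
      · rw [e1]; linarith
      · rw [e1, e2]; linarith
  push Not at hc
  obtain ⟨hT3, ht⟩ := hc
  set Q : Finset (Fin n) := Finset.univ.filter (fun i => 5 * 2 ^ Nat.log 2 (a i) ≤ 4 * a i) with hQ
  have hQm : ∀ i, i ∈ Q ↔ 5 * 2 ^ Nat.log 2 (a i) ≤ 4 * a i := fun i => by simp [hQ]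
  have hQ4 : ∀ i ∈ Q, 4 ≤ a i := by
    intro i hi
    have h1 := (hQm i).1 hi
    by_contra hcon
    have h2 := ha i
    have h3 : a i = 1 ∨ a i = 2 ∨ a i = 3 := by omega
    rcases h3 with h3 | h3 | h3
    · rw [h3] at h1; norm_num [Nat.log] at h1
    · rw [h3] at h1; norm_num [Nat.log] at h1
    · refine hT3 i ((hTm i).2 ?_) h3
      rw [h3]; unfold pwP; norm_num [Nat.log]
  have hQle : ∀ i ∈ Q, 5 * 2 ^ (Nat.log 2 (a i) - 2) ≤ a i := by
    intro i hi
    obtain ⟨q, hq⟩ := pw_log_ge (j := 2) (hQ4 i hi)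
    have h1 := (hQm i).1 hi
    rw [hq, pow_add] at h1
    rw [hq, Nat.add_sub_cancel]; omega
  have hQP : ∀ i ∈ Q, pwP (a i) →
      (1 : ℝ) / 2 ^ (Nat.log 2 (a i) - 2) ≤ 6 * (1 / (a i : ℝ)) := by
    intro i hi hp
    apply pw_loss (ha i)
    obtain ⟨q, hq⟩ := pw_log_ge (j := 2) (hQ4 i hi)
    unfold pwP at hp
    rw [hq, pow_add] at hp
    rw [hq, Nat.add_sub_cancel]
    have : a i ≤ 6 * 2 ^ q := by omega
    exact_mod_cast this
  have hQT : ∀ i ∈ Q, (1 : ℝ) / 2 ^ (Nat.log 2 (a i) - 2) ≤ 8 * (1 / (a i : ℝ)) := by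
    intro i hi
    apply pw_loss (ha i)
    obtain ⟨q, hq⟩ := pw_log_ge (j := 2) (hQ4 i hi)
    have hp := pw_hi (a i)
    rw [hq, pow_add] at hp
    rw [hq, Nat.add_sub_cancel]
    have : a i ≤ 8 * 2 ^ q := by omega
    exact_mod_cast this
  by_cases hR : (5 : ℝ) ≤ ∑ i ∈ Q, (1 : ℝ) / 2 ^ (Nat.log 2 (a i) - 2)
  · obtain ⟨F, hF, hs⟩ := pw_fill 5 (by norm_num) (fun i => Nat.log 2 (a i) - 2) Q
      (by exact_mod_cast hR)
    refine pw_goal a F (pw_sched hn a 5 (by norm_num) _ F (fun i hi => hQle i (hF hi)) hs.le) ?_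
    rw [pw_split F (fun i => pwP (a i))] at hs
    have s1 := pw_sum_le (F.filter (fun i => pwP (a i)))
      (fun i => (1 : ℝ) / 2 ^ (Nat.log 2 (a i) - 2)) (fun i => 1 / (a i : ℝ)) 6
      (fun i hi => by
        rw [Finset.mem_filter] at hi
        exact hQP i (hF hi.1) hi.2)
    have s2 := pw_sum_le (F.filter (fun i => ¬ pwP (a i)))
      (fun i => (1 : ℝ) / 2 ^ (Nat.log 2 (a i) - 2)) (fun i => 1 / (a i : ℝ)) 8
      (fun i hi => by
        rw [Finset.mem_filter] at hi
        exact hQT i (hF hi.1))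
    have e1 : (Finset.univ \ F).filter (fun i => pwP (a i)) =
        P \ F.filter (fun i => pwP (a i)) := by
      ext i; simp [hPm]; tauto
    have e2 : (Finset.univ \ F).filter (fun i => ¬ pwP (a i)) =
        T \ F.filter (fun i => ¬ pwP (a i)) := by
      ext i; simp [hTm]; tauto
    have d1 := Finset.sum_sdiff (f := fun i => 1 / (a i : ℝ))
      (Finset.filter_subset_filter (fun i => pwP (a i)) (Finset.subset_univ F))
    have d2 := Finset.sum_sdiff (f := fun i => 1 / (a i : ℝ))
      (Finset.filter_subset_filter (fun i => ¬ pwP (a i)) (Finset.subset_univ F))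
    rw [← hP] at d1
    rw [← hT] at d2
    have hcast : ((5 : ℕ) : ℝ) = 5 := by norm_num
    rw [hcast] at hs
    apply pw_sched2 hn a ha
    rw [e1, e2]
    linarith
  push Not at hR
  by_cases hX : (1 : ℝ) ≤ ∑ i ∈ Finset.univ \ Q, (1 : ℝ) / 2 ^ Nat.log 2 (a i)
  · refine pw_fill34 hn a ha hdens (Finset.univ \ Q) 1 one_pos (fun i => Nat.log 2 (a i))
      (fun i _ => by rw [one_mul]; exact pw_lo (ha i)) (5 / 4) ?_ (by norm_num) (by norm_num)
      (by exact_mod_cast hX)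
    intro i hi
    apply pw_loss (ha i)
    simp only [Finset.mem_sdiff, Finset.mem_univ, true_and, hQm, not_le] at hi
    have : (4 : ℝ) * a i ≤ 5 * 2 ^ Nat.log 2 (a i) := by exact_mod_cast hi.le
    linarith
  · push Not at hX
    refine pw_goal a Q (pw_sched hn a 5 (by norm_num) _ Q hQle (by exact_mod_cast hR.le)) ?_
    exact pw_sched hn a 1 one_pos (fun i => Nat.log 2 (a i)) _
      (fun i hi => by rw [one_mul]; exact pw_lo (ha i)) (by exact_mod_cast hX.le)

theorem pinwheel_partition_two (n : ℕ) (hn : 1 ≤ n) (a : Fin n → ℕ)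
    (ha : ∀ i, 1 ≤ a i)
    (hdens : ∑ i : Fin n, (1 : ℝ) / (a i : ℝ) ≤ 4 / 3) :
    ∃ S₁ S₂ : Set (Fin n),
      Disjoint S₁ S₂ ∧ S₁ ∪ S₂ = Set.univ ∧
      HasPinwheelSchedule a S₁ ∧ HasPinwheelSchedule a S₂ := by
  exact pw_main hn a ha hdens
end

section
/- In the query model in ℝ with n ≥ 2 objects, maximum speed v > 0, and the round-robin schedule q t = t mod n: for every valid trajectory family f, every time t, and every k, the k-th smallest value among the right endpoints (e i t)_{i : Fin n} of the uncertainty regions minus the k-th smallest value among the left endpoints (s i t)_{i : Fin n} is at most 2·v·(n−1). -/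
/-- The last time `s ≤ t` at which the exact position of object `i` was known:
either `s = 0` (initial positions are known) or object `i` was queried at time `s`. -/
def lastObs {n : ℕ} (q : ℕ → Fin n) (i : Fin n) (t : ℕ) : ℕ :=
  Nat.findGreatest (fun s => s = 0 ∨ q s = i) t

/-- Left endpoint of the uncertainty region of object `i` at time `t`. -/
noncomputable def sPt {n : ℕ} (v : ℝ) (f : Fin n → ℕ → ℝ) (q : ℕ → Fin n)
    (i : Fin n) (t : ℕ) : ℝ :=
  f i (lastObs q i t) - v * ((t - lastObs q i t : ℕ) : ℝ)

/-- Right endpoint of the uncertainty region of object `i` at time `t`. -/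
noncomputable def ePt {n : ℕ} (v : ℝ) (f : Fin n → ℕ → ℝ) (q : ℕ → Fin n)
    (i : Fin n) (t : ℕ) : ℝ :=
  f i (lastObs q i t) + v * ((t - lastObs q i t : ℕ) : ℝ)

/-- The uncertainty region of object `i` at time `t`. -/
noncomputable def uncReg {n : ℕ} (v : ℝ) (f : Fin n → ℕ → ℝ) (q : ℕ → Fin n)
    (i : Fin n) (t : ℕ) : Set ℝ :=
  Set.Icc (sPt v f q i t) (ePt v f q i t)

/-- The round-robin query schedule `q t = t mod n`. -/
def roundRobin (n : ℕ) (hn : 0 < n) : ℕ → Fin n :=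
  fun t => ⟨t % n, Nat.mod_lt t hn⟩

theorem rr_lag (n : ℕ) (hn : 0 < n) (i : Fin n) (t : ℕ) :
    t - lastObs (roundRobin n hn) i t ≤ n - 1 := by
  by_cases h : t < n
  · omega
  have hi := i.isLt
  have hm := Nat.mod_lt (t - i) hn
  have hle := Nat.mod_le (t - i) n
  have hd := Nat.div_add_mod (t - i) n
  have key : t - (t - i) % n ≤ lastObs (roundRobin n hn) i t := by
    unfold lastObs
    apply Nat.le_findGreatest (Nat.sub_le _ _)
    right
    apply Fin.ext
    have h1 : t - (t - i) % n = i + n * ((t - i) / n) := by omega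
    simp only [roundRobin]
    rw [h1, Nat.add_mul_mod_self_left, Nat.mod_eq_of_lt hi]
  omega

theorem sort_shift {n : ℕ} (e s : Fin n → ℝ) (C : ℝ) (h : ∀ i, e i ≤ s i + C) (k : Fin n) :
    e (Tuple.sort e k) ≤ s (Tuple.sort s k) + C := by
  have hex : ∃ a b : Fin n, a ≤ k ∧ k ≤ b ∧ Tuple.sort s a = Tuple.sort e b := by
    by_contra hcon
    push Not at hcon
    have hdis : Disjoint ((Finset.Iic k).map (Tuple.sort s).toEmbedding)
        ((Finset.Ici k).map (Tuple.sort e).toEmbedding) := by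
      rw [Finset.disjoint_left]
      intro x hx hy
      simp only [Finset.mem_map, Finset.mem_Iic, Finset.mem_Ici] at hx hy
      obtain ⟨a, ha, hax⟩ := hx
      obtain ⟨b, hb, hbx⟩ := hy
      exact hcon a b ha hb (hax.trans hbx.symm)
    have hc := Finset.card_le_univ (Finset.disjUnion _ _ hdis)
    rw [Finset.card_disjUnion, Finset.card_map, Finset.card_map, Fin.card_Iic, Fin.card_Ici,
      Fintype.card_fin] at hc
    have := k.isLt
    omega
  obtain ⟨a, b, ha, hb, hab⟩ := hex
  have h1 : e (Tuple.sort e k) ≤ e (Tuple.sort e b) := Tuple.monotone_sort e hb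
  have h2 : s (Tuple.sort s a) ≤ s (Tuple.sort s k) := Tuple.monotone_sort s ha
  have h3 := h (Tuple.sort s a)
  rw [← hab] at h1
  linarith

theorem roundRobin_orderStat_upper (n : ℕ) (hn : 2 ≤ n) (v : ℝ) (hv : 0 < v)
    (f : Fin n → ℕ → ℝ) (hf : ∀ i t, |f i (t + 1) - f i t| ≤ v)
    (t : ℕ) (k : Fin n) :
    (fun i => ePt v f (roundRobin n (by omega)) i t)
        (Tuple.sort (fun i => ePt v f (roundRobin n (by omega)) i t) k)
      - (fun i => sPt v f (roundRobin n (by omega)) i t)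
        (Tuple.sort (fun i => sPt v f (roundRobin n (by omega)) i t) k)
      ≤ 2 * v * ((n : ℝ) - 1) := by
  rw [sub_le_iff_le_add']
  refine sort_shift (fun i => ePt v f (roundRobin n (by omega)) i t)
    (fun i => sPt v f (roundRobin n (by omega)) i t) _ (fun i => ?_) k
  have h := rr_lag n (by omega) i t
  have h' : ((t - lastObs (roundRobin n (by omega)) i t : ℕ) : ℝ) ≤ (n : ℝ) - 1 := by
    have h2 : (((n - 1 : ℕ)) : ℝ) = (n : ℝ) - 1 := by
      rw [Nat.cast_sub (by omega)]; simp
    rw [← h2]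
    exact_mod_cast h
  have h3 := mul_le_mul_of_nonneg_left h' hv.le
  simp only [ePt, sPt]
  linarith
end
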